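/- Let Λ₁, Λ₂, D, K, M be symmetric positive definite real n×n matrices, and y₁, y₂ : [0,∞) → ℝⁿ C² curves satisfying Λᵢ·yᵢ'' + D·yᵢ' + K·yᵢ = F with F = −M·(y₁'' + y₂''). Then y₁'(t) → 0 and y₂'(t) → 0 as t → ∞, and there exist y₁*, y₂* ∈ ℝⁿ such that y₁(t) → y₁* and y₂(t) → y₂*; i.e., the two aerial manipulators converge to a certain configuration. (Paper's Theorem 3: convergence under collaborative grasping by two AMs.) -/

import Mathlib

open Matrix Filter Topology

section QuadraticForms

variable {ι : Type*} [Fintype ι]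

theorem Matrix.exists_abs_dotProduct_mulVec_le (A : Matrix ι ι ℝ) :
    ∃ C : ℝ, 0 < C ∧ ∀ x y : ι → ℝ, |x ⬝ᵥ A *ᵥ y| ≤ C * (x ⬝ᵥ x + y ⬝ᵥ y) := by
  refine ⟨∑ i, ∑ j, |A i j| + 1, by positivity, fun x y => ?_⟩
  have single_le (z : ι → ℝ) (i : ι) : z i ^ 2 ≤ z ⬝ᵥ z := by
    simpa [dotProduct, sq] using
      Finset.single_le_sum (f := fun i => z i * z i) (fun i _ => mul_self_nonneg (z i))
        (Finset.mem_univ i)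
  have hnonneg (z : ι → ℝ) : 0 ≤ z ⬝ᵥ z := Finset.sum_nonneg fun i _ => mul_self_nonneg (z i)
  calc |x ⬝ᵥ A *ᵥ y| = |∑ i, ∑ j, x i * (A i j * y j)| := by
        simp [dotProduct, mulVec, Finset.mul_sum]
    _ ≤ ∑ i, ∑ j, |x i * (A i j * y j)| :=
        (Finset.abs_sum_le_sum_abs _ _).trans
          (Finset.sum_le_sum fun i _ => Finset.abs_sum_le_sum_abs _ _)
    _ ≤ ∑ i, ∑ j, |A i j| * (x ⬝ᵥ x + y ⬝ᵥ y) := by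
        refine Finset.sum_le_sum fun i _ => Finset.sum_le_sum fun j _ => ?_
        have hxy : |x i| * |y j| ≤ x ⬝ᵥ x + y ⬝ᵥ y := by
          nlinarith [single_le x i, single_le y j, sq_nonneg (|x i| - |y j|), sq_abs (x i),
            sq_abs (y j), sq_nonneg (x i), sq_nonneg (y j)]
        calc |x i * (A i j * y j)| = |A i j| * (|x i| * |y j|) := by
              rw [abs_mul, abs_mul]; ring
          _ ≤ _ := by gcongr
    _ = (∑ i, ∑ j, |A i j|) * (x ⬝ᵥ x + y ⬝ᵥ y) := by
        simp only [Finset.sum_mul]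
    _ ≤ _ := by nlinarith [hnonneg x, hnonneg y]

theorem Matrix.PosDef.exists_mul_dotProduct_le {A : Matrix ι ι ℝ} (hA : A.PosDef) :
    ∃ a : ℝ, 0 < a ∧ ∀ x : ι → ℝ, a * (x ⬝ᵥ x) ≤ x ⬝ᵥ A *ᵥ x := by
  let S : Set (ι → ℝ) := {x | x ⬝ᵥ x = 1}
  have hS : IsCompact S := by
    refine Metric.isCompact_of_isClosed_isBounded
      (isClosed_eq (by fun_prop) continuous_const) ?_
    refine Metric.isBounded_closedBall (x := (0 : ι → ℝ)) (r := 1) |>.subset fun x hx => ?_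
    rw [mem_closedBall_zero_iff, pi_norm_le_iff_of_nonneg zero_le_one]
    intro i
    have h1 : x i * x i ≤ x ⬝ᵥ x :=
      Finset.single_le_sum (f := fun i => x i * x i) (fun i _ => mul_self_nonneg (x i))
        (Finset.mem_univ i)
    rw [show x ⬝ᵥ x = 1 from hx] at h1
    exact abs_le_one_iff_mul_self_le_one.2 h1
  have normalize {x : ι → ℝ} (hx : x ≠ 0) :
      0 < x ⬝ᵥ x ∧ (Real.sqrt (x ⬝ᵥ x))⁻¹ • x ∈ S := by
    have hpos : 0 < x ⬝ᵥ x := by simpa using dotProduct_star_self_pos_iff.2 hx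
    refine ⟨hpos, ?_⟩
    have := Real.sq_sqrt hpos.le
    have := Real.sqrt_pos.2 hpos
    simp only [S, Set.mem_ofPred_eq, smul_dotProduct, dotProduct_smul, smul_eq_mul]
    field_simp
    linarith
  rcases S.eq_empty_or_nonempty with hempty | hne
  · refine ⟨1, one_pos, fun x => ?_⟩
    by_cases hx : x = 0
    · simp [hx]
    · have := (normalize hx).2
      simp [hempty] at this
  · obtain ⟨z, hz, hmin⟩ := hS.exists_isMinOn hne
      (f := fun x => x ⬝ᵥ A *ᵥ x) (by fun_prop)
    have hz0 : z ≠ 0 := by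
      rintro rfl
      simp [S] at hz
    refine ⟨z ⬝ᵥ A *ᵥ z, by simpa using hA.dotProduct_mulVec_pos hz0, fun x => ?_⟩
    by_cases hx : x = 0
    · simp [hx]
    · obtain ⟨hpos, hmem⟩ := normalize hx
      have h := hmin hmem
      have hs := Real.sq_sqrt hpos.le
      have hs' := Real.sqrt_pos.2 hpos
      simp only [Set.mem_ofPred_eq, mulVec_smul, smul_dotProduct, dotProduct_smul,
        smul_eq_mul] at h
      rw [← mul_assoc, ← mul_inv, ← sq, hs, inv_mul_eq_div, le_div_iff₀ hpos] at h
      exact h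

theorem Matrix.IsHermitian.dotProduct_mulVec_comm {A : Matrix ι ι ℝ} (hA : A.IsHermitian)
    (x y : ι → ℝ) : x ⬝ᵥ A *ᵥ y = y ⬝ᵥ A *ᵥ x := by
  have hAT : Aᵀ = A := by simpa [IsHermitian] using hA
  rw [dotProduct_mulVec, ← mulVec_transpose, hAT, dotProduct_comm]

theorem HasDerivAt.dotProduct_mulVec (A : Matrix ι ι ℝ) {x y : ℝ → ι → ℝ} {x' y' : ι → ℝ}
    {t : ℝ} (hx : HasDerivAt x x' t) (hy : HasDerivAt y y' t) :
    HasDerivAt (fun s => x s ⬝ᵥ A *ᵥ y s) (x' ⬝ᵥ A *ᵥ y t + x t ⬝ᵥ A *ᵥ y') t := by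
  rw [hasDerivAt_pi] at hx hy
  have h := HasDerivAt.fun_sum (u := Finset.univ) fun i _ =>
    (hx i).fun_mul (HasDerivAt.fun_sum (u := Finset.univ) fun j _ => (hy j).const_mul (A i j))
  simpa only [dotProduct, mulVec, ← Finset.sum_add_distrib] using h

theorem tendsto_zero_of_dotProduct_self {α : Type*} {l : Filter α} {x : α → ι → ℝ}
    (h : Tendsto (fun a => x a ⬝ᵥ x a) l (𝓝 0)) : Tendsto x l (𝓝 0) := by
  rw [tendsto_pi_nhds]
  intro i
  have hsq : Tendsto (fun a => x a i ^ 2) l (𝓝 0) := by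
    refine squeeze_zero (fun a => sq_nonneg _) (fun a => ?_) h
    simpa [dotProduct, sq] using
      Finset.single_le_sum (f := fun i => x a i * x a i) (fun i _ => mul_self_nonneg (x a i))
        (Finset.mem_univ i)
  have habs : Tendsto (fun a => |x a i|) l (𝓝 0) := by
    simpa [Real.sqrt_sq_eq_abs] using hsq.sqrt
  exact (tendsto_zero_iff_abs_tendsto_zero _).2 habs

end QuadraticForms

theorem tendsto_zero_of_hasDerivAt_le_neg_mul {V V' : ℝ → ℝ} {k : ℝ} (hk : 0 < k)
    (hV : ∀ t, HasDerivAt V (V' t) t) (hV' : ∀ t, 0 ≤ t → V' t ≤ -(k * V t))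
    (hV0 : ∀ t, 0 ≤ V t) : Tendsto V atTop (𝓝 0) := by
  have hW (t : ℝ) : HasDerivAt (fun s => Real.exp (k * s) * V s)
      (Real.exp (k * t) * k * V t + Real.exp (k * t) * V' t) t := by
    have h := ((hasDerivAt_id t).const_mul k).exp.fun_mul (hV t)
    simpa using h
  have hanti : AntitoneOn (fun s => Real.exp (k * s) * V s) (Set.Ici 0) := by
    refine antitoneOn_of_deriv_nonpos (convex_Ici 0)
      (fun t _ => (hW t).continuousAt.continuousWithinAt)
      (fun t _ => (hW t).differentiableAt.differentiableWithinAt) fun t ht => ?_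
    rw [(hW t).deriv]
    rw [interior_Ici] at ht
    nlinarith [hV' t (le_of_lt ht), Real.exp_pos (k * t)]
  have hdecay : Tendsto (fun t => V 0 * Real.exp (-(k * t))) atTop (𝓝 0) := by
    simpa using (Real.tendsto_exp_neg_atTop_nhds_zero.comp
      (tendsto_id.const_mul_atTop hk)).const_mul (V 0)
  refine squeeze_zero' (Eventually.of_forall hV0) ?_ hdecay
  filter_upwards [eventually_ge_atTop 0] with t ht
  have h := hanti (Set.mem_Ici.2 le_rfl) (Set.mem_Ici.2 ht) ht
  simp only [mul_zero, Real.exp_zero, one_mul] at h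
  rw [Real.exp_neg, ← div_eq_mul_inv, le_div_iff₀ (Real.exp_pos _), mul_comm]
  exact h

/-- A linear mechanical system with positive definite inertia, damping and stiffness is
asymptotically stable. The Lyapunov function is the energy plus a small multiple of
`q ⬝ᵥ A *ᵥ q' + (q ⬝ᵥ D *ᵥ q) / 2`. -/
theorem Matrix.PosDef.tendsto_zero_of_mechanical_system {ι : Type*} [Fintype ι]
    {A D K : Matrix ι ι ℝ} (hA : A.PosDef) (hD : D.PosDef) (hK : K.PosDef)
    {q v w : ℝ → ι → ℝ} (hq : ∀ t, HasDerivAt q (v t) t) (hv : ∀ t, HasDerivAt v (w t) t)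
    (hODE : ∀ t, 0 ≤ t → A *ᵥ w t + D *ᵥ v t + K *ᵥ q t = 0) :
    Tendsto q atTop (𝓝 0) ∧ Tendsto v atTop (𝓝 0) := by
  obtain ⟨a₁, ha₁, hA_ge⟩ := hA.exists_mul_dotProduct_le
  obtain ⟨a₂, ha₂, hD_ge⟩ := hD.exists_mul_dotProduct_le
  obtain ⟨a₃, ha₃, hK_ge⟩ := hK.exists_mul_dotProduct_le
  obtain ⟨c₁, hc₁, hA_le⟩ := A.exists_abs_dotProduct_mulVec_le
  obtain ⟨c₂, hc₂, hD_le⟩ := D.exists_abs_dotProduct_mulVec_le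
  obtain ⟨c₃, hc₃, hK_le⟩ := K.exists_abs_dotProduct_mulVec_le
  have hnonneg (z : ι → ℝ) : 0 ≤ z ⬝ᵥ z := Finset.sum_nonneg fun i _ => mul_self_nonneg (z i)
  obtain ⟨ε, hε, hε₁, hε₂, hε₃⟩ : ∃ ε : ℝ, 0 < ε ∧ 4 * (ε * c₁) ≤ a₁ ∧ 4 * (ε * c₁) ≤ a₂ ∧
      4 * (ε * c₁) ≤ a₃ := by
    refine ⟨min a₁ (min a₂ a₃) / (4 * c₁), by positivity, ?_⟩
    have : 4 * (min a₁ (min a₂ a₃) / (4 * c₁) * c₁) = min a₁ (min a₂ a₃) := by field_simp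
    rw [this]
    simp
  set V : ℝ → ℝ := fun t => 1 / 2 * (v t ⬝ᵥ A *ᵥ v t) + 1 / 2 * (q t ⬝ᵥ K *ᵥ q t) +
    ε * (q t ⬝ᵥ A *ᵥ v t) + ε / 2 * (q t ⬝ᵥ D *ᵥ q t) with hV_def
  have hV (t : ℝ) := (((((hv t).dotProduct_mulVec A (hv t)).const_mul (1 / 2)).fun_add
    (((hq t).dotProduct_mulVec K (hq t)).const_mul (1 / 2))).fun_add
    (((hq t).dotProduct_mulVec A (hv t)).const_mul ε)).fun_add
    (((hq t).dotProduct_mulVec D (hq t)).const_mul (ε / 2))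
  obtain ⟨b, hb, hb₁, hb₃⟩ : ∃ b : ℝ, 0 < b ∧ 4 * b ≤ a₁ ∧ 4 * b ≤ a₃ :=
    ⟨min a₁ a₃ / 4, by positivity, by linarith [min_le_left a₁ a₃],
      by linarith [min_le_right a₁ a₃]⟩
  have hV_ge (t : ℝ) : b * (q t ⬝ᵥ q t + v t ⬝ᵥ v t) ≤ V t := by
    have h1 := hA_ge (v t)
    have h2 := hK_ge (q t)
    have h3 := mul_le_mul_of_nonneg_left (neg_le_of_abs_le (hA_le (q t) (v t))) hε.le
    have h4 := mul_nonneg hε.le ((mul_nonneg ha₂.le (hnonneg (q t))).trans (hD_ge (q t)))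
    have h5 := mul_le_mul_of_nonneg_right hb₁ (hnonneg (v t))
    have h6 := mul_le_mul_of_nonneg_right hb₃ (hnonneg (q t))
    have h7 := mul_le_mul_of_nonneg_right hε₁ (hnonneg (v t))
    have h8 := mul_le_mul_of_nonneg_right hε₃ (hnonneg (q t))
    simp only [hV_def]
    linarith
  set B : ℝ := c₁ + c₃ + ε * c₁ + ε * c₂ with hB
  have hB_pos : 0 < B := by positivity
  have hV_le (t : ℝ) : V t ≤ B * (q t ⬝ᵥ q t + v t ⬝ᵥ v t) := by
    have h1 := (abs_le.1 (hA_le (v t) (v t))).2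
    have h2 := (abs_le.1 (hK_le (q t) (q t))).2
    have h3 := mul_le_mul_of_nonneg_left (abs_le.1 (hA_le (q t) (v t))).2 hε.le
    have h4 := mul_le_mul_of_nonneg_left (abs_le.1 (hD_le (q t) (q t))).2 hε.le
    have h5 := mul_nonneg hc₁.le (hnonneg (q t))
    have h6 := mul_nonneg hc₃.le (hnonneg (v t))
    have h7 := mul_nonneg (mul_pos hε hc₂).le (hnonneg (v t))
    simp only [hV_def, hB]
    linarith
  obtain ⟨d, hd, hd₁, hd₂⟩ : ∃ d : ℝ, 0 < d ∧ 2 * d ≤ a₂ ∧ d ≤ ε * a₃ :=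
    ⟨min (a₂ / 2) (ε * a₃), by positivity, by linarith [min_le_left (a₂ / 2) (ε * a₃)],
      min_le_right _ _⟩
  have hV_lim : Tendsto V atTop (𝓝 0) := by
    refine tendsto_zero_of_hasDerivAt_le_neg_mul (div_pos hd hB_pos) hV (fun t ht => ?_)
      fun t => (mul_nonneg hb.le (add_nonneg (hnonneg _) (hnonneg _))).trans (hV_ge t)
    have hAw : A *ᵥ w t = -(D *ᵥ v t) - K *ᵥ q t := by
      rw [← sub_eq_zero, ← hODE t ht]; abel
    have hkV : d / B * V t ≤ d * (q t ⬝ᵥ q t + v t ⬝ᵥ v t) := by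
      rw [div_mul_eq_mul_div, div_le_iff₀ hB_pos]
      nlinarith [mul_le_mul_of_nonneg_left (hV_le t) hd.le]
    rw [hA.1.dotProduct_mulVec_comm (w t) (v t), hK.1.dotProduct_mulVec_comm (v t) (q t),
      hD.1.dotProduct_mulVec_comm (v t) (q t), hAw]
    simp only [dotProduct_sub, dotProduct_neg]
    rw [hK.1.dotProduct_mulVec_comm (v t) (q t)]
    have h1 := hD_ge (v t)
    have h2 := mul_le_mul_of_nonneg_left (hK_ge (q t)) hε.le
    have h3 := mul_le_mul_of_nonneg_left (abs_le.1 (hA_le (v t) (v t))).2 hε.le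
    have h4 := mul_le_mul_of_nonneg_right hε₂ (hnonneg (v t))
    have h5 := mul_le_mul_of_nonneg_right hd₁ (hnonneg (v t))
    have h6 := mul_le_mul_of_nonneg_right hd₂ (hnonneg (q t))
    linarith
  have hN : Tendsto (fun t => b⁻¹ * V t) atTop (𝓝 0) := by
    simpa using hV_lim.const_mul b⁻¹
  have hN_le (t : ℝ) : q t ⬝ᵥ q t + v t ⬝ᵥ v t ≤ b⁻¹ * V t := by
    rw [inv_mul_eq_div, le_div_iff₀ hb, mul_comm]
    exact hV_ge t
  constructor <;> apply tendsto_zero_of_dotProduct_self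
  · exact squeeze_zero (fun t => hnonneg _)
      (fun t => (le_add_of_nonneg_right (hnonneg (v t))).trans (hN_le t)) hN
  · exact squeeze_zero (fun t => hnonneg _)
      (fun t => (le_add_of_nonneg_left (hnonneg (q t))).trans (hN_le t)) hN

theorem Matrix.PosDef.fromBlocks_add_posSemidef {m : Type*} [Fintype m]
    {A B C : Matrix m m ℝ} (hA : A.PosDef) (hB : B.PosDef) (hC : C.PosSemidef) :
    (fromBlocks (A + C) C C (B + C)).PosDef := by
  refine .of_dotProduct_mulVec_pos (.fromBlocks (hA.1.add hC.1) hC.1 (hB.1.add hC.1))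
    fun x hx => ?_
  obtain ⟨u, v, rfl⟩ : ∃ u v : m → ℝ, x = Sum.elim u v :=
    ⟨x ∘ Sum.inl, x ∘ Sum.inr, (Sum.elim_comp_inl_inr x).symm⟩
  have hCuv := hC.dotProduct_mulVec_nonneg (u + v)
  have hAu := hA.posSemidef.dotProduct_mulVec_nonneg u
  have hBv := hB.posSemidef.dotProduct_mulVec_nonneg v
  simp only [star_trivial] at hCuv hAu hBv ⊢
  have hsum : Sum.elim u v ⬝ᵥ fromBlocks (A + C) C C (B + C) *ᵥ Sum.elim u v =
      u ⬝ᵥ A *ᵥ u + v ⬝ᵥ B *ᵥ v + (u + v) ⬝ᵥ C *ᵥ (u + v) := by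
    simp only [fromBlocks_mulVec, Sum.elim_comp_inl, Sum.elim_comp_inr,
      sumElim_dotProduct_sumElim, add_mulVec, mulVec_add, dotProduct_add, add_dotProduct]
    ring
  rw [hsum]
  by_cases hu : u = 0
  · have hv : v ≠ 0 := by
      rintro rfl
      exact hx (by simp [hu])
    have := hB.dotProduct_mulVec_pos hv
    simp only [star_trivial] at this
    linarith
  · have := hA.dotProduct_mulVec_pos hu
    simp only [star_trivial] at this
    linarith

theorem HasDerivAt.sumElim {m n : Type*} [Fintype m] [Fintype n] {f : ℝ → m → ℝ}
    {g : ℝ → n → ℝ} {f' : m → ℝ} {g' : n → ℝ} {t : ℝ} (hf : HasDerivAt f f' t)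
    (hg : HasDerivAt g g' t) :
    HasDerivAt (fun s => Sum.elim (f s) (g s)) (Sum.elim f' g') t := by
  rw [hasDerivAt_pi] at hf hg ⊢
  rintro (i | i)
  · exact hf i
  · exact hg i

/-- Theorem 3 (convergence under collaborative grasping by two AMs).
With `F = −M (y₁'' + y₂'')`, both end-effector velocities tend to `0` and both
configurations converge to some limits `y₁*, y₂*`. -/
theorem stmt_9 {n : ℕ} (Λ₁ Λ₂ D K M : Matrix (Fin n) (Fin n) ℝ)
    (hΛ₁ : Λ₁.PosDef) (hΛ₂ : Λ₂.PosDef) (hD : D.PosDef) (hK : K.PosDef)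
    (hM : M.PosDef)
    (y₁ y₂ : ℝ → Fin n → ℝ) (hy₁ : ContDiff ℝ 2 y₁) (hy₂ : ContDiff ℝ 2 y₂)
    (F : ℝ → Fin n → ℝ)
    (hF : ∀ t : ℝ, F t = -(M *ᵥ (deriv (deriv y₁) t + deriv (deriv y₂) t)))
    (hODE₁ : ∀ t : ℝ, 0 ≤ t →
      Λ₁ *ᵥ (deriv (deriv y₁) t) + D *ᵥ (deriv y₁ t) + K *ᵥ (y₁ t) = F t)
    (hODE₂ : ∀ t : ℝ, 0 ≤ t →
      Λ₂ *ᵥ (deriv (deriv y₂) t) + D *ᵥ (deriv y₂ t) + K *ᵥ (y₂ t) = F t) :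
    Tendsto (deriv y₁) atTop (𝓝 0) ∧ Tendsto (deriv y₂) atTop (𝓝 0) ∧
    ∃ y₁star y₂star : Fin n → ℝ,
      Tendsto y₁ atTop (𝓝 y₁star) ∧ Tendsto y₂ atTop (𝓝 y₂star) := by
  have hderiv {y : ℝ → Fin n → ℝ} (hy : ContDiff ℝ 2 y) (t : ℝ) :
      HasDerivAt y (deriv y t) t ∧ HasDerivAt (deriv y) (deriv (deriv y) t) t :=
    ⟨(hy.differentiable (by norm_num) t).hasDerivAt,
      ((hy.deriv' (n := 1)).differentiable (by norm_num) t).hasDerivAt⟩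
  have hblock {A : Matrix (Fin n) (Fin n) ℝ} (hA : A.PosDef) :
      (fromBlocks A 0 0 A).PosDef := by
    simpa using hA.fromBlocks_add_posSemidef hA .zero
  obtain ⟨hq, hv⟩ := (hΛ₁.fromBlocks_add_posSemidef hΛ₂
    hM.posSemidef).tendsto_zero_of_mechanical_system (hblock hD) (hblock hK)
    (fun t => (hderiv hy₁ t).1.sumElim (hderiv hy₂ t).1)
    (fun t => (hderiv hy₁ t).2.sumElim (hderiv hy₂ t).2) (fun t ht => by
      have h₁ := hODE₁ t ht
      have h₂ := hODE₂ t ht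
      rw [hF, ← add_eq_zero_iff_eq_neg, mulVec_add] at h₁ h₂
      simp only [fromBlocks_mulVec, Sum.elim_comp_inl, Sum.elim_comp_inr, zero_mulVec, add_zero,
        zero_add, add_mulVec, ← Sum.elim_add_add]
      rw [← Sum.elim_zero_zero]
      congr 1
      · rw [← h₁]; abel
      · rw [← h₂]; abel)
  rw [tendsto_pi_nhds] at hq hv
  exact ⟨tendsto_pi_nhds.2 fun i => hv (Sum.inl i), tendsto_pi_nhds.2 fun i => hv (Sum.inr i),
    0, 0, tendsto_pi_nhds.2 fun i => hq (Sum.inl i), tendsto_pi_nhds.2 fun i => hq (Sum.inr i)⟩
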